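/- Let R be a finite nontrivial ring with identity. Then every point of P(R) is distant to exactly |R| points; that is, every vertex of the distant graph of R has degree equal to the cardinality of R. -/

import Mathlib

/-- A pair is admissible if it is the first row of some invertible 2×2 matrix. -/
def Admissible (R : Type*) [Ring R] (v : R × R) : Prop :=
  ∃ M : Matrix (Fin 2) (Fin 2) R, IsUnit M ∧ M 0 0 = v.1 ∧ M 0 1 = v.2

/-- The type of admissible pairs. -/
def AdmissiblePair (R : Type*) [Ring R] := {v : R × R // Admissible R v}

/-- Two admissible pairs are associated if one is obtained from the other by left
multiplication by a unit. -/
def ProjAssoc (R : Type*) [Ring R] (v w : AdmissiblePair R) : Prop :=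
  ∃ u : Rˣ, v.1.1 = (u : R) * w.1.1 ∧ v.1.2 = (u : R) * w.1.2

/-- The projective line over a ring: admissible pairs modulo unit multiples. -/
def ProjLine (R : Type*) [Ring R] := Quot (ProjAssoc R)

/-- The point of the projective line determined by an admissible pair. -/
def ProjLine.mk (R : Type*) [Ring R] (v : AdmissiblePair R) : ProjLine R :=
  Quot.mk (ProjAssoc R) v

/-- Two points are distant if (for some, equivalently any, representatives) the 2×2 matrix
formed from the representatives is invertible. -/
def Distant (R : Type*) [Ring R] (x y : ProjLine R) : Prop :=
  ∃ (a b c d : R) (h₁ : Admissible R (a, b)) (h₂ : Admissible R (c, d)),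
    x = ProjLine.mk R ⟨(a, b), h₁⟩ ∧ y = ProjLine.mk R ⟨(c, d), h₂⟩ ∧
    IsUnit !![a, b; c, d]


theorem projAssoc_equivalence (R : Type*) [Ring R] : Equivalence (ProjAssoc R) where
  refl v := ⟨1, by simp, by simp⟩
  symm := by
    rintro v w ⟨u, h₁, h₂⟩
    exact ⟨u⁻¹, by rw [h₁, Units.inv_mul_cancel_left], by rw [h₂, Units.inv_mul_cancel_left]⟩
  trans := by
    rintro v w x ⟨u, h₁, h₂⟩ ⟨u', h₃, h₄⟩
    exact ⟨u * u', by rw [h₁, h₃, Units.val_mul, mul_assoc],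
      by rw [h₂, h₄, Units.val_mul, mul_assoc]⟩

theorem ProjLine.mk_eq_mk_iff {R : Type*} [Ring R] {v w : AdmissiblePair R} :
    ProjLine.mk R v = ProjLine.mk R w ↔ ProjAssoc R v w :=
  Quot.eq.trans (projAssoc_equivalence R).eqvGen_iff

/-- A lower unitriangular 2×2 matrix is invertible. -/
theorem isUnit_lowerUnitriangular {R : Type*} [Ring R] (t : R) : IsUnit !![1, 0; t, 1] :=
  isUnit_iff_exists.mpr ⟨!![1, 0; -t, 1], by simp [Matrix.one_fin_two],
    by simp [Matrix.one_fin_two]⟩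

/-- The matrix exchanging the two coordinates is invertible. -/
theorem isUnit_exchange (R : Type*) [Ring R] : IsUnit (!![0, 1; 1, 0] : Matrix (Fin 2) (Fin 2) R) :=
  isUnit_iff_exists.mpr ⟨!![0, 1; 1, 0], by simp [Matrix.one_fin_two],
    by simp [Matrix.one_fin_two]⟩

/-- The second row of an invertible 2×2 matrix is admissible. -/
theorem admissible_of_isUnit {R : Type*} [Ring R] {a b c d : R} (h : IsUnit !![a, b; c, d]) :
    Admissible R (c, d) :=
  ⟨!![0, 1; 1, 0] * !![a, b; c, d], (isUnit_exchange R).mul h, by simp,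
    by simp⟩

/-- Adding a left multiple of the first row to the second preserves invertibility. -/
theorem isUnit_addRow {R : Type*} [Ring R] {a b c d : R} (h : IsUnit !![a, b; c, d]) (t : R) :
    IsUnit !![a, b; t * a + c, t * b + d] := by
  simpa [Matrix.mul_fin_two] using (isUnit_lowerUnitriangular t).mul h

/-- If a lower triangular 2×2 matrix is invertible and its first diagonal entry is a unit,
then so is the second. -/
theorem isUnit_of_isUnit_lowerTriangular {R : Type*} [Ring R] (u : Rˣ) {s w : R}
    (h : IsUnit !![(u : R), 0; s, w]) : IsUnit w := by
  obtain ⟨N, h₁, h₂⟩ := isUnit_iff_exists.mp h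
  rw [Matrix.eta_fin_two N, Matrix.mul_fin_two, Matrix.one_fin_two] at h₁ h₂
  have h01 := congrFun (congrFun h₁ 0) 1
  have h11 := congrFun (congrFun h₁ 1) 1
  have h11' := congrFun (congrFun h₂ 1) 1
  simp at h01 h11 h11'
  rw [h01, mul_zero, zero_add] at h11
  exact isUnit_iff_exists.mpr ⟨_, h11, h11'⟩

/-- The rows of an invertible 2×2 matrix are left linearly independent. -/
theorem coeff_eq_of_isUnit {R : Type*} [Ring R] {a b c d : R} (h : IsUnit !![a, b; c, d])
    {s w s' w' : R} (h₁ : s * a + w * c = s' * a + w' * c)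
    (h₂ : s * b + w * d = s' * b + w' * d) : s = s' ∧ w = w' := by
  have key : !![s, w; 0, 0] * !![a, b; c, d] = !![s', w'; 0, 0] * !![a, b; c, d] := by
    simp [h₁, h₂]
  have hk := h.mul_right_cancel key
  exact ⟨congrFun (congrFun hk 0) 0, congrFun (congrFun hk 0) 1⟩

/-- The rows of an invertible 2×2 matrix span. -/
theorem exists_coeff_of_isUnit {R : Type*} [Ring R] {a b c d : R} (h : IsUnit !![a, b; c, d])
    (x y : R) : ∃ s w : R, s * a + w * c = x ∧ s * b + w * d = y := by
  obtain ⟨N, -, hN⟩ := isUnit_iff_exists.mp h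
  have key : (!![x, y; 0, 0] * N) * !![a, b; c, d] = !![x, y; 0, 0] := by
    rw [mul_assoc, hN, mul_one]
  rw [Matrix.eta_fin_two (!![x, y; 0, 0] * N), Matrix.mul_fin_two] at key
  exact ⟨_, _, congrFun (congrFun key 0) 0, congrFun (congrFun key 0) 1⟩

/-- The point with coordinates `(t, 1)` relative to the rows of an invertible matrix. -/
def affinePoint {R : Type*} [Ring R] {a b c d : R} (h : IsUnit !![a, b; c, d]) (t : R) :
    ProjLine R :=
  ProjLine.mk R ⟨(t * a + c, t * b + d), admissible_of_isUnit (isUnit_addRow h t)⟩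

theorem affinePoint_injective {R : Type*} [Ring R] {a b c d : R} (h : IsUnit !![a, b; c, d]) :
    Function.Injective (affinePoint h) := by
  intro t s hts
  obtain ⟨u, h₁, h₂⟩ := ProjLine.mk_eq_mk_iff.mp hts
  dsimp only at h₁ h₂
  obtain ⟨hs, hu⟩ := coeff_eq_of_isUnit h (s := t) (w := 1) (s' := u * s) (w' := u)
    (by rw [one_mul, h₁, mul_add, mul_assoc]) (by rw [one_mul, h₂, mul_add, mul_assoc])
  rw [hs, ← hu, one_mul]

theorem range_affinePoint {R : Type*} [Ring R] {a b c d : R} (h : IsUnit !![a, b; c, d])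
    (hab : Admissible R (a, b)) :
    Set.range (affinePoint h) = {x | Distant R (ProjLine.mk R ⟨(a, b), hab⟩) x} := by
  ext x
  constructor
  · rintro ⟨t, rfl⟩
    exact ⟨a, b, _, _, hab, _, rfl, rfl, isUnit_addRow h t⟩
  · rintro ⟨a', b', c', d', h₁, h₂, hp, rfl, hN⟩
    obtain ⟨u, ha, hb⟩ := ProjLine.mk_eq_mk_iff.mp hp.symm
    dsimp only at ha hb
    obtain ⟨s, w, hc, hd⟩ := exists_coeff_of_isUnit h c' d'
    have hK : !![(u : R), 0; s, w] * !![a, b; c, d] = !![a', b'; c', d'] := by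
      simp [ha, hb, hc, hd]
    rw [← hK] at hN
    obtain ⟨v, rfl⟩ := isUnit_of_isUnit_lowerTriangular u
      ((Units.isUnit_mul_units _ h.unit).mp hN)
    refine ⟨(↑v⁻¹ : R) * s, ProjLine.mk_eq_mk_iff.mpr ⟨v⁻¹, ?_, ?_⟩⟩
    · simp [← hc, mul_add, mul_assoc]
    · simp [← hd, mul_add, mul_assoc]

/-- Every point of the projective line over a finite nontrivial ring `R` is distant to
exactly `|R|` points. -/
theorem card_distant_set (R : Type*) [Ring R] [Fintype R] [Nontrivial R]
    (p : ProjLine R) :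
    Nat.card {x : ProjLine R | Distant R p x} = Nat.card R := by
  obtain ⟨⟨⟨a, b⟩, hab⟩, rfl⟩ := Quot.exists_rep p
  obtain ⟨M, hM, ha, hb⟩ := id hab
  dsimp only at ha hb
  rw [Matrix.eta_fin_two M, ha, hb] at hM
  change Nat.card {x | Distant R (ProjLine.mk R ⟨(a, b), hab⟩) x} = Nat.card R
  rw [← range_affinePoint hM hab]
  exact Nat.card_range_of_injective (affinePoint_injective hM)
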